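/- Let E be a Gysin functor on a finitary lextensive category C. Suppose given morphisms f : Z → Y, g : Z → X, f' : Z' → X, g' : Z' → U in C, elements a ∈ E(Z), a' ∈ E(Z'), and a pullback P of g : Z → X and f' : Z' → X with projections s : P → Z and t : P → Z'. Then in the category of correspondences C_E one has (Rf ∘ Da ∘ Ig) ∘ (Rf' ∘ Da' ∘ Ig') = R(f ∘ s) ∘ D(s^*(a) · t^*(a')) ∘ I(g' ∘ t). In particular (taking a = a' = 1, f = id, g' = id), for a pullback square with projections s, t of g and f' one has Ig ∘ Rf' = Rs ∘ It. -/

import Mathlib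

open CategoryTheory CategoryTheory.Limits

universe v u

/-- A Gysin functor on a finitary lextensive category `C`. -/
structure GysinFunctor (C : Type u) [Category.{v} C] [HasFiniteLimits C]
    [HasFiniteCoproducts C] [FinitaryExtensive C] where
  /-- The underlying rings. -/
  E : C → Type v
  commRing : ∀ X : C, CommRing (E X)
  /-- Contravariant functoriality (pullback), by ring maps. -/
  pull : ∀ {X Y : C}, (X ⟶ Y) → (E Y →+* E X)
  pull_id : ∀ X : C, pull (𝟙 X) = RingHom.id (E X)
  pull_comp : ∀ {X Y Z : C} (f : X ⟶ Y) (g : Y ⟶ Z),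
    pull (f ≫ g) = (pull f).comp (pull g)
  /-- Covariant functoriality (pushforward/Gysin maps), by additive maps. -/
  push : ∀ {X Y : C}, (X ⟶ Y) → (E X →+ E Y)
  push_id : ∀ X : C, push (𝟙 X) = AddMonoidHom.id (E X)
  push_comp : ∀ {X Y Z : C} (f : X ⟶ Y) (g : Y ⟶ Z),
    push (f ≫ g) = (push g).comp (push f)
  /-- Zero axiom: `E ∅ = 0`. -/
  zero : Subsingleton (E (⊥_ C))
  /-- Behavior on sums. -/
  coprod_bij : ∀ X Y : C, Function.Bijective
    (fun a : E (X ⨿ Y) => (pull coprod.inl a, pull coprod.inr a))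
  /-- Push-product axiom. -/
  push_product : ∀ {X X' Y Y' : C} (f : X ⟶ X') (g : Y ⟶ Y') (a : E X) (b : E Y),
    push (prod.map f g) (pull prod.fst a * pull prod.snd b)
      = pull prod.fst (push f a) * pull prod.snd (push g b)
  /-- Push-pull axiom. -/
  push_pull : ∀ {A B C' D' : C} (f : A ⟶ B) (p : A ⟶ C') (q : B ⟶ D') (g : C' ⟶ D'),
    IsPullback f p q g → ∀ a : E C', push f (pull p a) = pull q (push g a)

namespace GysinFunctor

attribute [instance] GysinFunctor.commRing

variable {C : Type u} [Category.{v} C] [HasFiniteLimits C]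
  [HasFiniteCoproducts C] [FinitaryExtensive C] (G : GysinFunctor C)

/-- Hom-groups of the category of correspondences: `C_E(A, B) = E(B × A)`. -/
noncomputable def Hom (A B : C) : Type v := G.E (B ⨯ A)

noncomputable instance (A B : C) : AddCommGroup (G.Hom A B) :=
  inferInstanceAs (AddCommGroup (G.E (B ⨯ A)))

/-- Composition in the category of correspondences. -/
noncomputable def comp {A B Cc : C} (β : G.Hom B Cc) (α : G.Hom A B) : G.Hom A Cc :=
  G.push (prod.map prod.fst (𝟙 A) : (Cc ⨯ B) ⨯ A ⟶ Cc ⨯ A)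
    (G.pull (prod.fst : (Cc ⨯ B) ⨯ A ⟶ Cc ⨯ B) β *
      G.pull (prod.map prod.snd (𝟙 A) : (Cc ⨯ B) ⨯ A ⟶ B ⨯ A) α)

/-- The identity morphism `i_A = Δ_!(1)` in the category of correspondences. -/
noncomputable def ident (A : C) : G.Hom A A := G.push (diag A) 1

/-- `Rf`, the forward map associated to `f : A ⟶ B`. -/
noncomputable def Rmor {A B : C} (f : A ⟶ B) : G.Hom A B :=
  G.push (prod.lift f (𝟙 A)) 1

/-- `If`, the transfer map associated to `f : A ⟶ B`. -/
noncomputable def Imor {A B : C} (f : A ⟶ B) : G.Hom B A :=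
  G.push (prod.lift (𝟙 A) f) 1

/-- `Da`, the diagonal endomorphism associated to `a ∈ E(A)`. -/
noncomputable def Dmor {A : C} (a : G.E A) : G.Hom A A := G.push (diag A) a

/-- The duality anti-automorphism on hom-groups. -/
noncomputable def star {A B : C} (α : G.Hom A B) : G.Hom B A :=
  G.pull (prod.braiding A B).hom α

end GysinFunctor

namespace GysinFunctor

section

variable {C : Type u} [Category.{v} C]

/-- The graph of `f` as the pullback of the diagonal along `f × 𝟙`. -/
theorem isPullback_graph [HasBinaryProducts C] {A B : C} (f : A ⟶ B) :
    IsPullback f (prod.lift (𝟙 A) f) (diag B) (prod.map f (𝟙 B)) := by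
  refine ⟨⟨by ext <;> simp⟩, ⟨PullbackCone.IsLimit.mk _ (fun c => c.snd ≫ prod.fst) ?_ ?_ ?_⟩⟩
  · intro c
    simpa [prod.lift_fst, prod.lift_snd] using (congrArg (· ≫ prod.fst) c.condition).symm
  · intro c
    have h₁ := congrArg (· ≫ prod.fst) c.condition
    have h₂ := congrArg (· ≫ prod.snd) c.condition
    ext <;> simp_all [prod.lift_fst, prod.lift_snd]
  · intro c m _ h
    simp [← h, prod.lift_fst]

theorem isPullback_map_fst [HasBinaryProducts C] {W V : C} (l : W ⟶ V) (A : C) :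
    IsPullback (prod.map l (𝟙 A)) prod.fst prod.fst l := by
  refine ⟨⟨by simp⟩, ⟨PullbackCone.IsLimit.mk _
    (fun c => prod.lift c.snd (c.fst ≫ prod.snd)) ?_ ?_ ?_⟩⟩
  · intro c
    have h := c.condition
    ext <;> simp_all [prod.lift_fst, prod.lift_snd]
  · intro c
    simp [prod.lift_fst]
  · intro c m h₁ h₂
    ext
    · simp [← h₂, prod.lift_fst]
    · simp [← h₁, prod.lift_snd]

/-- A pullback of spans over the middle object, presented over the product with the outer foot. -/
theorem isPullback_lift [HasBinaryProducts C] {A B W W' P : C} {q : W ⟶ B} {p' : W' ⟶ B}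
    (q' : W' ⟶ A) {s : P ⟶ W} {t : P ⟶ W'} (h : IsPullback s t q p') :
    IsPullback (prod.lift s (t ≫ q')) t (prod.map q (𝟙 A)) (prod.lift p' q') := by
  refine ⟨⟨by ext <;> simp [h.w, prod.lift_fst, prod.lift_snd]⟩, ⟨PullbackCone.IsLimit.mk _
    (fun c => h.lift (c.fst ≫ prod.fst) c.snd
      (by simpa [prod.lift_fst, prod.lift_snd] using congrArg (· ≫ prod.fst) c.condition)) ?_ ?_ ?_⟩⟩
  · intro c
    have h₂ := congrArg (· ≫ prod.snd) c.condition
    ext <;> simp_all [prod.lift_fst, prod.lift_snd]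
  · intro c
    simp
  · intro c m h₁ h₂
    apply h.hom_ext
    · simp [← h₁, prod.lift_fst]
    · simp [← h₂]

end

variable {C : Type u} [Category.{v} C] [HasFiniteLimits C]
  [HasFiniteCoproducts C] [FinitaryExtensive C] (G : GysinFunctor C)

theorem pull_pull {X Y Z : C} (f : X ⟶ Y) (g : Y ⟶ Z) (a : G.E Z) :
    G.pull f (G.pull g a) = G.pull (f ≫ g) a := by
  rw [G.pull_comp]; rfl

theorem push_push {X Y Z : C} (f : X ⟶ Y) (g : Y ⟶ Z) (a : G.E X) :
    G.push g (G.push f a) = G.push (f ≫ g) a := by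
  rw [G.push_comp]; rfl

theorem pull_id_apply {X : C} (a : G.E X) : G.pull (𝟙 X) a = a := by
  rw [G.pull_id]; rfl

theorem push_id_apply {X : C} (a : G.E X) : G.push (𝟙 X) a = a := by
  rw [G.push_id]; rfl

/-- The projection formula (Frobenius reciprocity). -/
theorem push_mul_pull {A B : C} (f : A ⟶ B) (a : G.E A) (b : G.E B) :
    G.push f (a * G.pull f b) = G.push f a * b := by
  have h := G.push_pull _ _ _ _ (isPullback_graph f) (G.pull prod.fst a * G.pull prod.snd b)
  rw [G.push_product] at h
  simpa [pull_pull, pull_id_apply, push_id_apply, prod.lift_fst, prod.lift_snd] using h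

/-- The correspondence associated to a span `B ⟵ W ⟶ A` weighted by `a ∈ E(W)`. -/
noncomputable def spanHom {A B W : C} (p : W ⟶ B) (q : W ⟶ A) (a : G.E W) : G.Hom A B :=
  G.push (prod.lift p q) a

/-- Weighted spans compose by pullback, multiplying the pulled back weights. -/
theorem comp_spanHom {A B D W W' P : C} (p : W ⟶ D) (q : W ⟶ B) (b : G.E W)
    (p' : W' ⟶ B) (q' : W' ⟶ A) (a : G.E W') {s : P ⟶ W} {t : P ⟶ W'}
    (h : IsPullback s t q p') :
    G.comp (G.spanHom p q b) (G.spanHom p' q' a) =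
      G.spanHom (s ≫ p) (t ≫ q') (G.pull s b * G.pull t a) := by
  unfold comp spanHom
  rw [← G.push_pull _ _ _ _ (isPullback_map_fst (prod.lift p q) A), ← push_mul_pull, pull_pull]
  have e : prod.map (prod.lift p q) (𝟙 A) ≫ prod.map prod.snd (𝟙 A) = prod.map q (𝟙 A) := by
    simp [prod.lift_snd]
  rw [e, ← G.push_pull _ _ _ _ (isPullback_lift q' h), mul_comm, ← push_mul_pull, pull_pull,
    push_push, push_push, mul_comm]
  simp [prod.lift_fst]
  rfl

theorem Rmor_eq_spanHom {A B : C} (f : A ⟶ B) : G.Rmor f = G.spanHom f (𝟙 A) 1 := rfl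

theorem Imor_eq_spanHom {A B : C} (f : A ⟶ B) : G.Imor f = G.spanHom (𝟙 A) f 1 := rfl

theorem Dmor_eq_spanHom {A : C} (a : G.E A) : G.Dmor a = G.spanHom (𝟙 A) (𝟙 A) a := rfl

/-- The `RDI` form of a weighted span. -/
theorem comp_Rmor_Dmor_Imor {A B W : C} (p : W ⟶ B) (q : W ⟶ A) (a : G.E W) :
    G.comp (G.Rmor p) (G.comp (G.Dmor a) (G.Imor q)) = G.spanHom p q a := by
  rw [Rmor_eq_spanHom, Dmor_eq_spanHom, Imor_eq_spanHom,
    G.comp_spanHom _ _ _ _ _ _ (IsPullback.id_horiz (𝟙 W)),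
    G.comp_spanHom _ _ _ _ _ _ (IsPullback.of_vert_isIso (fst := 𝟙 W) (snd := 𝟙 W) ⟨by simp⟩)]
  simp [pull_id_apply]

end GysinFunctor

open GysinFunctor in
/-- Composition of two morphisms in `RDI` form, via a pullback; in particular
`Ig ∘ Rf' = Rs ∘ It` for a pullback square. -/
theorem gysinFunctor_RDI_comp
    {C : Type u} [Category.{v} C] [HasFiniteLimits C]
    [HasFiniteCoproducts C] [FinitaryExtensive C] (G : GysinFunctor C)
    {X Y U Z Z' P : C} (f : Z ⟶ Y) (g : Z ⟶ X) (f' : Z' ⟶ X) (g' : Z' ⟶ U)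
    (a : G.E Z) (a' : G.E Z')
    (s : P ⟶ Z) (t : P ⟶ Z') (hP : IsPullback s t g f') :
    G.comp (G.comp (G.Rmor f) (G.comp (G.Dmor a) (G.Imor g)))
        (G.comp (G.Rmor f') (G.comp (G.Dmor a') (G.Imor g')))
      = G.comp (G.Rmor (s ≫ f))
          (G.comp (G.Dmor (G.pull s a * G.pull t a')) (G.Imor (t ≫ g'))) ∧
    G.comp (G.Imor g) (G.Rmor f') = G.comp (G.Rmor s) (G.Imor t) := by
  constructor
  · rw [comp_Rmor_Dmor_Imor, comp_Rmor_Dmor_Imor, comp_Rmor_Dmor_Imor]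
    exact G.comp_spanHom _ _ _ _ _ _ hP
  · rw [Imor_eq_spanHom, Rmor_eq_spanHom, Rmor_eq_spanHom, Imor_eq_spanHom,
      G.comp_spanHom _ _ _ _ _ _ hP, G.comp_spanHom _ _ _ _ _ _ (IsPullback.id_horiz (𝟙 P))]
    simp
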